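/- (Differential Privacy of the plausible-deniability mechanism F.) In the plausible-deniability mechanism setup, additionally assume that for every s ∈ U the family (p s y)_{y ∈ U} is summable with Σ_{y ∈ U} p s y ≤ 1. Let t be an integer with 1 ≤ t < k, and set ε = ε₀ + ln(1 + γ/t) and δ = exp(-ε₀·(k - t)). Let D and D' be finite subsets of U with |D| ≥ k and |D'| ≥ k that are neighboring, i.e., D' = D ∪ {d'} for some d' ∉ D, or D = D' ∪ {d} for some d ∉ D'. Then for every set Y ⊆ U: Σ_{y ∈ Y} PF(D', y) ≤ exp(ε) · Σ_{y ∈ Y} PF(D, y) + δ. -/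

import Mathlib

open Finset

attribute [local instance] Classical.propDecidable

noncomputable section PD

variable {U : Type*}

/-- Partition number: the unique `i : ℕ` with `γ^{-(i+1)} < x ≤ γ^{-i}` (for `0 < x ≤ 1`),
    given by `⌊-log_γ x⌋`. -/
def Ipart (γ x : ℝ) : ℕ := ⌊-Real.logb γ x⌋₊

/-- Partition set `C_i(D, y) = {d ∈ D : p d y > 0 ∧ I_d(y) = i}`. -/
def Cpart (p : U → U → ℝ) (γ : ℝ) (D : Finset U) (y : U) (i : ℕ) : Finset U :=
  D.filter fun d => 0 < p d y ∧ Ipart γ (p d y) = i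

/-- Laplace upper-tail function `Pr[L ≥ x]` for `L ~ Lap(1/ε₀)`. -/
def lapTail (ε₀ x : ℝ) : ℝ :=
  if 0 ≤ x then (1 / 2) * Real.exp (-(ε₀ * x)) else 1 - (1 / 2) * Real.exp (ε₀ * x)

/-- Probability of passing the randomized privacy test from partition `i`. -/
def pt (p : U → U → ℝ) (γ ε₀ : ℝ) (k : ℕ) (D : Finset U) (i : ℕ) (y : U) : ℝ :=
  lapTail ε₀ ((k : ℝ) - ((Cpart p γ D y i).card : ℝ))

/-- Probability of producing `y` from partition `i`. -/
def q (p : U → U → ℝ) (γ ε₀ : ℝ) (k : ℕ) (D : Finset U) (i : ℕ) (y : U) : ℝ :=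
  pt p γ ε₀ k D i y * ∑ s ∈ Cpart p γ D y i, p s y

/-- Probability that the mechanism `F` on input dataset `D` releases `y`. -/
def PF (p : U → U → ℝ) (γ ε₀ : ℝ) (k : ℕ) (D : Finset U) (y : U) : ℝ :=
  (1 / (D.card : ℝ)) *
    ∑ s ∈ D.filter (fun s => 0 < p s y), p s y * pt p γ ε₀ k D (Ipart γ (p s y)) y

lemma lapTail_nonneg {ε₀ : ℝ} (hε : 0 < ε₀) (x : ℝ) : 0 ≤ lapTail ε₀ x := by
  unfold lapTail
  split_ifs with h
  · positivity
  · have : Real.exp (ε₀ * x) ≤ 1 := Real.exp_le_one_iff.2 (by nlinarith)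
    linarith

lemma lapTail_le_one {ε₀ : ℝ} (hε : 0 < ε₀) (x : ℝ) : lapTail ε₀ x ≤ 1 := by
  unfold lapTail
  split_ifs with h
  · have : Real.exp (-(ε₀ * x)) ≤ 1 := Real.exp_le_one_iff.2 (by nlinarith)
    linarith
  · linarith [Real.exp_pos (ε₀ * x)]

lemma lapTail_antitone {ε₀ : ℝ} (hε : 0 < ε₀) : Antitone (lapTail ε₀) := by
  intro x y hxy
  unfold lapTail
  split_ifs with hy hx hx
  · have : Real.exp (-(ε₀ * y)) ≤ Real.exp (-(ε₀ * x)) := Real.exp_le_exp.2 (by nlinarith)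
    linarith
  · have h1 : Real.exp (-(ε₀ * y)) ≤ 1 := Real.exp_le_one_iff.2 (by nlinarith)
    have h2 : Real.exp (ε₀ * x) ≤ 1 := Real.exp_le_one_iff.2 (by nlinarith)
    linarith
  · linarith
  · have : Real.exp (ε₀ * x) ≤ Real.exp (ε₀ * y) := Real.exp_le_exp.2 (by nlinarith)
    linarith

lemma lapTail_sub_one_le {ε₀ : ℝ} (hε : 0 < ε₀) (x : ℝ) :
    lapTail ε₀ (x - 1) ≤ Real.exp ε₀ * lapTail ε₀ x := by
  unfold lapTail
  have hE : 1 ≤ Real.exp ε₀ := Real.one_le_exp hε.le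
  split_ifs with h1 h2 h2
  · have : Real.exp (-(ε₀ * (x - 1))) = Real.exp ε₀ * Real.exp (-(ε₀ * x)) := by
      rw [← Real.exp_add]; ring_nf
    rw [this]; linarith
  · linarith
  · have h3 : Real.exp ε₀ * Real.exp (-(ε₀ * x)) = Real.exp (-(ε₀ * (x - 1))) := by
      rw [← Real.exp_add]; ring_nf
    have h4 := Real.add_one_le_exp (-(ε₀ * (x - 1)))
    have h5 := Real.add_one_le_exp (ε₀ * (x - 1))
    linarith
  · have hu : Real.exp (ε₀ * x) ≤ 1 := Real.exp_le_one_iff.2 (by nlinarith)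
    have hu' := Real.exp_pos (ε₀ * x)
    have h3 : Real.exp (ε₀ * x) = Real.exp ε₀ * Real.exp (ε₀ * (x - 1)) := by
      rw [← Real.exp_add]; ring_nf
    have hv := Real.exp_pos (ε₀ * (x - 1))
    have hvu : Real.exp (ε₀ * (x - 1)) ≤ Real.exp (ε₀ * x) := Real.exp_le_exp.2 (by nlinarith)
    nlinarith [mul_nonneg (sub_nonneg.2 hE) (sub_nonneg.2 hu),
      mul_nonneg (sub_nonneg.2 hE) (sub_nonneg.2 (hvu.trans hu))]

lemma pt_nonneg (p : U → U → ℝ) (γ : ℝ) {ε₀ : ℝ} (hε : 0 < ε₀) (k : ℕ) (D : Finset U)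
    (i : ℕ) (y : U) : 0 ≤ pt p γ ε₀ k D i y :=
  lapTail_nonneg hε _

lemma pt_mono (p : U → U → ℝ) (γ : ℝ) {ε₀ : ℝ} (hε : 0 < ε₀) (k : ℕ) {D E : Finset U}
    (h : D ⊆ E) (i : ℕ) (y : U) : pt p γ ε₀ k D i y ≤ pt p γ ε₀ k E i y := by
  have hcard : ((Cpart p γ D y i).card : ℝ) ≤ (Cpart p γ E y i).card := by
    exact_mod_cast Finset.card_le_card (Finset.filter_subset_filter _ h)
  exact lapTail_antitone hε (by linarith)

lemma card_Cpart_insert_le (p : U → U → ℝ) (γ : ℝ) (D : Finset U) (d y : U) (i : ℕ) :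
    (Cpart p γ (insert d D) y i).card ≤ (Cpart p γ D y i).card + 1 := by
  unfold Cpart
  rw [Finset.filter_insert]
  split_ifs
  · exact Finset.card_insert_le _ _
  · omega

lemma pt_insert_le (p : U → U → ℝ) (γ : ℝ) {ε₀ : ℝ} (hε : 0 < ε₀) (k : ℕ) (D : Finset U)
    (d : U) (i : ℕ) (y : U) :
    pt p γ ε₀ k (insert d D) i y ≤ Real.exp ε₀ * pt p γ ε₀ k D i y := by
  refine le_trans (lapTail_antitone hε ?_) (lapTail_sub_one_le hε _)
  have : ((Cpart p γ (insert d D) y i).card : ℝ) ≤ (Cpart p γ D y i).card + 1 := by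
    exact_mod_cast card_Cpart_insert_le p γ D d y i
  linarith

lemma le_mul_of_Ipart_eq {γ a b : ℝ} (hγ : 1 < γ) (ha : 0 < a) (ha1 : a ≤ 1) (hb : 0 < b)
    (h : Ipart γ a = Ipart γ b) : a ≤ γ * b := by
  have h1 : (Ipart γ a : ℝ) ≤ -Real.logb γ a :=
    Nat.floor_le (neg_nonneg.2 (Real.logb_nonpos hγ ha.le ha1))
  have h2 : -Real.logb γ b < (Ipart γ b : ℝ) + 1 := Nat.lt_floor_add_one _
  have h3 : Real.logb γ (γ * b) = 1 + Real.logb γ b := by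
    rw [Real.logb_mul (by positivity) hb.ne', Real.logb_self_eq_one hγ]
  rw [h] at h1
  exact (Real.logb_le_logb hγ ha (by positivity)).1 (by linarith)

lemma PF_eq {p : U → U → ℝ} (hp : ∀ d y, 0 ≤ p d y ∧ p d y ≤ 1) (γ ε₀ : ℝ) (k : ℕ)
    (D : Finset U) (y : U) :
    PF p γ ε₀ k D y =
      (1 / (D.card : ℝ)) * ∑ s ∈ D, p s y * pt p γ ε₀ k D (Ipart γ (p s y)) y := by
  unfold PF
  congr 1
  refine Finset.sum_subset (Finset.filter_subset _ _) fun s hs hs' => ?_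
  have : p s y = 0 := le_antisymm (by simpa [hs] using hs') (hp s y).1
  simp [this]

lemma PF_nonneg {p : U → U → ℝ} (hp : ∀ d y, 0 ≤ p d y ∧ p d y ≤ 1) (γ : ℝ) {ε₀ : ℝ}
    (hε : 0 < ε₀) (k : ℕ) (D : Finset U) (y : U) : 0 ≤ PF p γ ε₀ k D y :=
  mul_nonneg (by positivity) (Finset.sum_nonneg fun s _ =>
    mul_nonneg (hp s y).1 (pt_nonneg p γ hε k D _ y))

lemma summable_PF {p : U → U → ℝ} (hp : ∀ d y, 0 ≤ p d y ∧ p d y ≤ 1)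
    (hsum : ∀ s : U, Summable fun y : U => p s y) (γ : ℝ) {ε₀ : ℝ} (hε : 0 < ε₀) (k : ℕ)
    (D : Finset U) : Summable fun y : U => PF p γ ε₀ k D y := by
  simp only [PF_eq hp]
  refine Summable.mul_left _ (summable_sum fun s _ => ?_)
  exact Summable.of_nonneg_of_le (fun y => mul_nonneg (hp s y).1 (pt_nonneg p γ hε k D _ y))
    (fun y => mul_le_of_le_one_right (hp s y).1 (lapTail_le_one hε _)) (hsum s)

/-- Contribution of an added record whose partition already holds at least `t` records. -/
lemma mul_pt_le_sum {γ ε₀ : ℝ} (hγ : 1 < γ) (hε : 0 < ε₀) (k : ℕ) {t : ℕ} (ht : 1 ≤ t)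
    {p : U → U → ℝ} (hp : ∀ d y, 0 ≤ p d y ∧ p d y ≤ 1) (D : Finset U) (d y : U)
    (hd : 0 < p d y) (hcard : t ≤ (Cpart p γ D y (Ipart γ (p d y))).card) :
    p d y * pt p γ ε₀ k D (Ipart γ (p d y)) y ≤
      γ / t * ∑ s ∈ D, p s y * pt p γ ε₀ k D (Ipart γ (p s y)) y := by
  have ht0 : (0 : ℝ) < t := by exact_mod_cast ht
  set j := Ipart γ (p d y) with hj
  have hP := pt_nonneg p γ hε k D j y
  have hS : (t : ℝ) * p d y ≤ γ * ∑ s ∈ Cpart p γ D y j, p s y := by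
    calc (t : ℝ) * p d y ≤ (Cpart p γ D y j).card * p d y := by gcongr
      _ = ∑ _s ∈ Cpart p γ D y j, p d y := by simp
      _ ≤ ∑ s ∈ Cpart p γ D y j, γ * p s y := by
          refine Finset.sum_le_sum fun s hs => ?_
          obtain ⟨-, hs0, hsj⟩ := Finset.mem_filter.1 hs
          exact le_mul_of_Ipart_eq hγ hd (hp d y).2 hs0 hsj.symm
      _ = _ := by rw [Finset.mul_sum]
  have hsub : (∑ s ∈ Cpart p γ D y j, p s y) * pt p γ ε₀ k D j y ≤
      ∑ s ∈ D, p s y * pt p γ ε₀ k D (Ipart γ (p s y)) y := by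
    rw [Finset.sum_mul]
    calc _ = ∑ s ∈ Cpart p γ D y j, p s y * pt p γ ε₀ k D (Ipart γ (p s y)) y :=
          Finset.sum_congr rfl fun s hs => by rw [(Finset.mem_filter.1 hs).2.2]
      _ ≤ _ := Finset.sum_le_sum_of_subset_of_nonneg (Finset.filter_subset _ _)
          fun s _ _ => mul_nonneg (hp s y).1 (pt_nonneg p γ hε k D _ y)
  have hS' : p d y ≤ γ / t * ∑ s ∈ Cpart p γ D y j, p s y := by
    rw [div_mul_eq_mul_div, le_div_iff₀ ht0]; linarith
  calc p d y * pt p γ ε₀ k D j y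
      ≤ (γ / t * ∑ s ∈ Cpart p γ D y j, p s y) * pt p γ ε₀ k D j y := by gcongr
    _ = γ / t * ((∑ s ∈ Cpart p γ D y j, p s y) * pt p γ ε₀ k D j y) := by ring
    _ ≤ _ := by gcongr

lemma PF_insert_le {γ ε₀ : ℝ} (hγ : 1 < γ) (hε : 0 < ε₀) {k t : ℕ} (ht : 1 ≤ t)
    (htk : t < k) {p : U → U → ℝ} (hp : ∀ d y, 0 ≤ p d y ∧ p d y ≤ 1) {D : Finset U}
    (hD : k ≤ D.card) {d : U} (hd : d ∉ D) (y : U) :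
    PF p γ ε₀ k (insert d D) y ≤
      Real.exp ε₀ * (1 + γ / t) * PF p γ ε₀ k D y +
        Real.exp (-(ε₀ * ((k : ℝ) - t))) * p d y := by
  have ht0 : (0 : ℝ) < t := by exact_mod_cast ht
  have hN : (1 : ℝ) ≤ D.card := by exact_mod_cast (by omega : 1 ≤ D.card)
  have hE := Real.exp_pos ε₀
  have hδ := Real.exp_pos (-(ε₀ * ((k : ℝ) - t)))
  have hd0 := (hp d y).1
  rw [PF_eq hp, PF_eq hp, Finset.card_insert_of_notMem hd, Finset.sum_insert hd]
  set S := ∑ s ∈ D, p s y * pt p γ ε₀ k D (Ipart γ (p s y)) y with hS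
  have hS0 : 0 ≤ S := Finset.sum_nonneg fun s _ =>
    mul_nonneg (hp s y).1 (pt_nonneg p γ hε k D _ y)
  have hrest : ∑ s ∈ D, p s y * pt p γ ε₀ k (insert d D) (Ipart γ (p s y)) y ≤
      Real.exp ε₀ * S := by
    rw [hS, Finset.mul_sum]
    refine Finset.sum_le_sum fun s _ => ?_
    have := mul_le_mul_of_nonneg_left (pt_insert_le p γ hε k D d (Ipart γ (p s y)) y) (hp s y).1
    linarith
  have hnew : p d y * pt p γ ε₀ k (insert d D) (Ipart γ (p d y)) y ≤
      Real.exp ε₀ * (γ / t) * S + Real.exp (-(ε₀ * ((k : ℝ) - t))) * p d y := by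
    rcases hd0.eq_or_lt with h0 | hpos
    · rw [← h0]; simp only [zero_mul, mul_zero, add_zero]; positivity
    rcases le_or_gt t (Cpart p γ D y (Ipart γ (p d y))).card with hc | hc
    · have h1 := mul_le_mul_of_nonneg_left (pt_insert_le p γ hε k D d (Ipart γ (p d y)) y) hd0
      have h2 := mul_le_mul_of_nonneg_left (mul_pt_le_sum hγ hε k ht hp D d y hpos hc) hE.le
      have h3 := mul_nonneg hδ.le hd0
      linarith
    · have hle : pt p γ ε₀ k (insert d D) (Ipart γ (p d y)) y ≤ lapTail ε₀ ((k : ℝ) - t) := by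
        refine lapTail_antitone hε (sub_le_sub_left ?_ _)
        exact_mod_cast (card_Cpart_insert_le p γ D d y (Ipart γ (p d y))).trans hc
      have htk' : (0 : ℝ) ≤ (k : ℝ) - t := sub_nonneg.2 (by exact_mod_cast htk.le)
      rw [lapTail, if_pos htk'] at hle
      have h1 := mul_le_mul_of_nonneg_left hle hd0
      have h2 : 0 ≤ Real.exp ε₀ * (γ / t) * S := by positivity
      nlinarith [mul_nonneg hδ.le hd0]
  push_cast
  have hr : 1 / ((D.card : ℝ) + 1) ≤ 1 / (D.card : ℝ) := by gcongr; linarith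
  have hr1 : 1 / (D.card : ℝ) ≤ 1 := by rw [div_le_one (by linarith)]; exact hN
  calc _ ≤ 1 / ((D.card : ℝ) + 1) * (Real.exp ε₀ * (1 + γ / t) * S +
          Real.exp (-(ε₀ * ((k : ℝ) - t))) * p d y) :=
        mul_le_mul_of_nonneg_left (by linarith) (by positivity)
    _ ≤ 1 / (D.card : ℝ) * (Real.exp ε₀ * (1 + γ / t) * S +
          Real.exp (-(ε₀ * ((k : ℝ) - t))) * p d y) := by gcongr
    _ ≤ _ := by
      have := mul_le_mul_of_nonneg_right hr1 (mul_nonneg hδ.le hd0)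
      linarith

lemma PF_le_insert (γ : ℝ) {ε₀ : ℝ} (hε : 0 < ε₀) (k : ℕ)
    {p : U → U → ℝ} (hp : ∀ d y, 0 ≤ p d y ∧ p d y ≤ 1) {D : Finset U}
    (hD : 0 < D.card) {d : U} (hd : d ∉ D) (y : U) :
    PF p γ ε₀ k D y ≤ (1 + 1 / (D.card : ℝ)) * PF p γ ε₀ k (insert d D) y := by
  have hN : (0 : ℝ) < D.card := by exact_mod_cast hD
  rw [PF_eq hp, PF_eq hp, Finset.card_insert_of_notMem hd, ← mul_assoc]
  have hc : (1 + 1 / (D.card : ℝ)) * (1 / ((D.card + 1 : ℕ) : ℝ)) = 1 / (D.card : ℝ) := by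
    push_cast; field_simp
  rw [hc]
  gcongr
  calc _ ≤ ∑ s ∈ D, p s y * pt p γ ε₀ k (insert d D) (Ipart γ (p s y)) y :=
        Finset.sum_le_sum fun s _ => mul_le_mul_of_nonneg_left
          (pt_mono p γ hε k (Finset.subset_insert d D) _ y) (hp s y).1
    _ ≤ _ := Finset.sum_le_sum_of_subset_of_nonneg (Finset.subset_insert d D)
        fun s _ _ => mul_nonneg (hp s y).1 (pt_nonneg p γ hε k _ _ y)

/-- Differential privacy of the plausible-deniability mechanism `F`: for neighboring
datasets `D, D'` of size at least `k`, and any set of outcomes `Y`,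
`Pr[F(D') ∈ Y] ≤ e^ε · Pr[F(D) ∈ Y] + δ` for `ε = ε₀ + ln(1 + γ/t)` and
`δ = e^{-ε₀(k-t)}`. -/
theorem mechanism_differential_privacy (γ ε₀ : ℝ) (hγ : 1 < γ) (hε : 0 < ε₀)
    (k : ℕ) (hk : 1 ≤ k) (t : ℕ) (ht : 1 ≤ t) (htk : t < k)
    (ε δ : ℝ) (hεdef : ε = ε₀ + Real.log (1 + γ / (t : ℝ)))
    (hδdef : δ = Real.exp (-(ε₀ * ((k : ℝ) - t))))
    (p : U → U → ℝ) (hp : ∀ d y, 0 ≤ p d y ∧ p d y ≤ 1)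
    (hsum : ∀ s : U, Summable (fun y : U => p s y) ∧ (∑' y : U, p s y) ≤ 1)
    (D D' : Finset U) (hD : k ≤ D.card) (hDcard' : k ≤ D'.card)
    (hneighbor : (∃ d' : U, d' ∉ D ∧ D' = insert d' D) ∨
                 (∃ d : U, d ∉ D' ∧ D = insert d D'))
    (Y : Set U) :
    (∑' y : Y, PF p γ ε₀ k D' (y : U)) ≤
      Real.exp ε * (∑' y : Y, PF p γ ε₀ k D (y : U)) + δ := by
  have ht0 : (0 : ℝ) < t := by exact_mod_cast ht
  have hγt : 0 < γ / (t : ℝ) := by positivity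
  have hexp : Real.exp ε = Real.exp ε₀ * (1 + γ / t) := by
    rw [hεdef, Real.exp_add, Real.exp_log (by positivity)]
  have hsumm (E : Finset U) : Summable fun y : Y => PF p γ ε₀ k E (y : U) :=
    (summable_PF hp (fun s => (hsum s).1) γ hε k E).subtype Y
  rcases hneighbor with ⟨d, hd, rfl⟩ | ⟨d, hd, rfl⟩
  · have hpd : Summable fun y : Y => p d y := (hsum d).1.subtype Y
    have hpd1 : ∑' y : Y, p d y ≤ 1 :=
      (Summable.tsum_subtype_le (p d) Y (fun y => (hp d y).1) (hsum d).1).trans (hsum d).2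
    have hδ : 0 ≤ δ := hδdef ▸ (Real.exp_pos _).le
    calc _ ≤ ∑' y : Y, (Real.exp ε * PF p γ ε₀ k D y + δ * p d y) :=
          (hsumm _).tsum_le_tsum (fun y => by
            rw [hexp, hδdef]; exact PF_insert_le hγ hε ht htk hp hD hd y)
            (((hsumm D).mul_left _).add (hpd.mul_left _))
      _ = Real.exp ε * ∑' y : Y, PF p γ ε₀ k D y + δ * ∑' y : Y, p d y := by
          rw [((hsumm D).mul_left _).tsum_add (hpd.mul_left _), tsum_mul_left, tsum_mul_left]
      _ ≤ _ := by nlinarith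
  · have hN : (t : ℝ) ≤ D'.card := by exact_mod_cast (by omega : t ≤ D'.card)
    have hfac : 1 + 1 / (D'.card : ℝ) ≤ Real.exp ε := by
      have h1 : 1 / (D'.card : ℝ) ≤ γ / t := by gcongr
      have h2 : 1 ≤ Real.exp ε₀ := Real.one_le_exp hε.le
      rw [hexp]
      nlinarith
    have hδ : 0 ≤ δ := hδdef ▸ (Real.exp_pos _).le
    rw [← tsum_mul_left]
    refine le_add_of_le_of_nonneg ((hsumm _).tsum_le_tsum (fun y => ?_)
      ((hsumm _).mul_left _)) hδ
    exact (PF_le_insert γ hε k hp (by omega) hd y).trans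
      (mul_le_mul_of_nonneg_right hfac (PF_nonneg hp γ hε k _ y))

end PD
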